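/- (Symmetry of the normalized eigenfunctions, Remark 2.3.) Let A = diag(1,−1,−1) and let u,v : ℝ² → ℂ be continuously differentiable. Suppose that for every λ ∈ ℂ the map μ(·,·,λ) : ℝ² → GL₃(ℂ) is continuously differentiable and satisfies μ_x + iλ²[Λ,μ] = V₁μ and μ_t − 2iλ⁴[Λ,μ] = V₂μ on ℝ² (with V₁ = V₁(x,t,λ), V₂ = V₂(x,t,λ)), and that at some base point (x₀,t₀) one has μ(x₀,t₀,λ)^{−1} = A·conj(μ(x₀,t₀, conj(λ)))ᵀ·A for every λ ∈ ℂ. Then μ(x,t,λ)^{−1} = A·conj(μ(x,t, conj(λ)))ᵀ·A for all (x,t) ∈ ℝ² and all λ ∈ ℂ. -/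

import Mathlib

open Matrix Complex ComplexConjugate

noncomputable section

abbrev M3 := Matrix (Fin 3) (Fin 3) ℂ

/-- `Λ = diag(-1,1,1)` -/
def Lam : M3 := !![(-1 : ℂ), 0, 0; 0, 1, 0; 0, 0, 1]

/-- `A = diag(1,-1,-1)` -/
def Amat : M3 := !![(1 : ℂ), 0, 0; 0, -1, 0; 0, 0, -1]

/-- partial derivative in the first (space) variable -/
def pdx (f : ℝ × ℝ → ℂ) (p : ℝ × ℝ) : ℂ := deriv (fun x => f (x, p.2)) p.1

/-- partial derivative in the second (time) variable -/
def pdt (f : ℝ × ℝ → ℂ) (p : ℝ × ℝ) : ℂ := deriv (fun t => f (p.1, t)) p.2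

/-- entrywise partial x-derivative of a matrix-valued function -/
def pdxM (F : ℝ × ℝ → M3) (p : ℝ × ℝ) : M3 :=
  Matrix.of fun i j => deriv (fun x => F (x, p.2) i j) p.1

/-- entrywise partial t-derivative of a matrix-valued function -/
def pdtM (F : ℝ × ℝ → M3) (p : ℝ × ℝ) : M3 :=
  Matrix.of fun i j => deriv (fun t => F (p.1, t) i j) p.2

/-- `ρ = |u|² + |v|²` -/
def rho (u v : ℝ × ℝ → ℂ) (p : ℝ × ℝ) : ℂ := conj (u p) * u p + conj (v p) * v p

def U1mat (u v : ℝ × ℝ → ℂ) (p : ℝ × ℝ) : M3 :=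
  !![0, u p, v p; conj (u p), 0, 0; conj (v p), 0, 0]

def U2mat (u v : ℝ × ℝ → ℂ) (p : ℝ × ℝ) : M3 :=
  !![-(rho u v p), 0, 0;
     0, conj (u p) * u p, conj (u p) * v p;
     0, u p * conj (v p), conj (v p) * v p]

def U3mat (u v : ℝ × ℝ → ℂ) (p : ℝ × ℝ) : M3 :=
  !![0, u p * rho u v p - I * pdx u p, v p * rho u v p - I * pdx v p;
     conj (u p) * rho u v p + I * pdx (fun q => conj (u q)) p, 0, 0;
     conj (v p) * rho u v p + I * pdx (fun q => conj (v q)) p, 0, 0]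

/-- `U(x,t,λ) = -iλ²Λ + λU₁` -/
def Umat (u v : ℝ × ℝ → ℂ) (lam : ℂ) (p : ℝ × ℝ) : M3 :=
  (-(I * lam ^ 2)) • Lam + lam • U1mat u v p

/-- `V(x,t,λ) = 2iλ⁴Λ - 2λ³U₁ + iλ²U₂ - λU₃` -/
def Vmat (u v : ℝ × ℝ → ℂ) (lam : ℂ) (p : ℝ × ℝ) : M3 :=
  (2 * I * lam ^ 4) • Lam - (2 * lam ^ 3) • U1mat u v p + (I * lam ^ 2) • U2mat u v p
    - lam • U3mat u v p

/-- `V₁ = λU₁` -/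
def V1mat (u v : ℝ × ℝ → ℂ) (lam : ℂ) (p : ℝ × ℝ) : M3 := lam • U1mat u v p

/-- `V₂ = -2λ³U₁ + iλ²U₂ - λU₃` -/
def V2mat (u v : ℝ × ℝ → ℂ) (lam : ℂ) (p : ℝ × ℝ) : M3 :=
  (-(2 * lam ^ 3)) • U1mat u v p + (I * lam ^ 2) • U2mat u v p - lam • U3mat u v p

theorem hasDerivAt_matrix_mul_apply {F G : ℝ → M3} {F' G' : M3} {s : ℝ}
    (hF : ∀ i j, HasDerivAt (fun r => F r i j) (F' i j) s)
    (hG : ∀ i j, HasDerivAt (fun r => G r i j) (G' i j) s) (i j : Fin 3) :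
    HasDerivAt (fun r => (F r * G r) i j) ((F' * G s + F s * G') i j) s := by
  simp only [Matrix.add_apply, Matrix.mul_apply, ← Finset.sum_add_distrib]
  exact HasDerivAt.fun_sum fun k _ => (hF i k).mul (hG k j)

theorem hasDerivAt_conjugate_conjTranspose_apply (B : M3) {F : ℝ → M3} {F' : M3} {s : ℝ}
    (hF : ∀ i j, HasDerivAt (fun r => F r i j) (F' i j) s) (i j : Fin 3) :
    HasDerivAt (fun r => (B * (F r)ᴴ * B) i j) ((B * F'ᴴ * B) i j) s := by
  have hB : ∀ i j, HasDerivAt (fun _ : ℝ => B i j) ((0 : M3) i j) s :=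
    fun i j => hasDerivAt_const s (B i j)
  have hFstar : ∀ i j, HasDerivAt (fun r => (F r)ᴴ i j) (F'ᴴ i j) s := fun i j => (hF j i).star
  simpa using hasDerivAt_matrix_mul_apply (hasDerivAt_matrix_mul_apply hB hFstar) hB i j

theorem eq_zero_of_hasDerivAt_mul {f : ℝ → ℂ} {k : ℂ}
    (hf : ∀ s, HasDerivAt f (k * f s) s) {s₀ : ℝ} (h₀ : f s₀ = 0) (s : ℝ) : f s = 0 := by
  have hg : ∀ r : ℝ, HasDerivAt (fun r : ℝ => f r * exp (-k * r)) 0 r := fun r => by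
    have he : HasDerivAt (fun r : ℝ => exp (-k * r)) (exp (-k * r) * (-k * 1)) r :=
      (ofRealCLM.hasDerivAt.const_mul (-k)).cexp
    exact ((hf r).mul he).congr_deriv (by ring)
  have hconst := is_const_of_deriv_eq_zero (fun r => (hg r).differentiableAt)
    (fun r => (hg r).deriv) s s₀
  simpa [h₀, exp_ne_zero] using hconst

theorem Lam_eq_diagonal : Lam = diagonal ![-1, 1, 1] := by
  ext i j
  fin_cases i <;> fin_cases j <;> simp [Lam]

theorem eq_one_of_hasDerivAt_commutator {Q : ℝ → M3} {c : ℂ}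
    (hQ : ∀ s i j, HasDerivAt (fun r => Q r i j) ((c • (Lam * Q s - Q s * Lam)) i j) s)
    {s₀ : ℝ} (h₀ : Q s₀ = 1) (s : ℝ) : Q s = 1 := by
  ext i j
  refine sub_eq_zero.mp (eq_zero_of_hasDerivAt_mul (f := fun r => Q r i j - (1 : M3) i j)
    (k := c * (Lam i i - Lam j j)) (s₀ := s₀) (fun r => ?_) (by simp [h₀]) s)
  refine ((hQ r i j).sub_const _).congr_deriv ?_
  have hone : (Lam i i - Lam j j) * (1 : M3) i j = 0 := by
    obtain rfl | hij := eq_or_ne i j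
    · simp
    · simp [hij]
  simp only [Lam_eq_diagonal, Matrix.smul_apply, Matrix.sub_apply, diagonal_mul, mul_diagonal,
    diagonal_apply_eq, smul_eq_mul] at hone ⊢
  linear_combination c * hone

theorem Amat_mul_Lam : Amat * Lam = Lam * Amat := by
  ext i j
  fin_cases i <;> fin_cases j <;> simp [Amat, Lam, Matrix.mul_apply, Fin.sum_univ_three]

theorem conjTranspose_Lam : Lamᴴ = Lam := by
  ext i j
  fin_cases i <;> fin_cases j <;> simp [Lam]

/-- Two solutions of commutator equations with adjoint coefficients keep the relation
`A·nᴴ·A·m = 1` along the line. -/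
theorem Amat_conjTranspose_mul_eq_one {m n V W : ℝ → M3} {c d : ℂ}
    (hm : ∀ s i j, HasDerivAt (fun r => m r i j)
      ((c • (Lam * m s - m s * Lam) + V s * m s) i j) s)
    (hn : ∀ s i j, HasDerivAt (fun r => n r i j)
      ((d • (Lam * n s - n s * Lam) + W s * n s) i j) s)
    (hd : conj d = -c) (hW : ∀ s, (W s)ᴴ * Amat = -(Amat * V s))
    {s₀ : ℝ} (h₀ : Amat * (n s₀)ᴴ * Amat * m s₀ = 1) (s : ℝ) :
    Amat * (n s)ᴴ * Amat * m s = 1 := by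
  refine eq_one_of_hasDerivAt_commutator (Q := fun r => Amat * (n r)ᴴ * Amat * m r) (c := c)
    (fun r i j => ?_) h₀ s
  refine (hasDerivAt_matrix_mul_apply
    (hasDerivAt_conjugate_conjTranspose_apply Amat (hn r)) (hm r) i j).congr_deriv
    (congrArg (fun M : M3 => M i j) ?_)
  have hA : Amat * (d • (Lam * n r - n r * Lam) + W r * n r)ᴴ * Amat
      = c • (Lam * (Amat * (n r)ᴴ * Amat) - Amat * (n r)ᴴ * Amat * Lam)
        - Amat * (n r)ᴴ * Amat * V r := by
    have h₁ : Amat * ((n r)ᴴ * (W r)ᴴ) * Amat = -(Amat * (n r)ᴴ * Amat * V r) := by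
      rw [← mul_assoc, mul_assoc _ (W r)ᴴ, hW, mul_neg, ← mul_assoc]
    have h₂ : Amat * ((n r)ᴴ * Lam) * Amat = Amat * (n r)ᴴ * Amat * Lam := by
      rw [mul_assoc _ Amat Lam, Amat_mul_Lam]
      simp only [mul_assoc]
    have h₃ : Amat * (Lam * (n r)ᴴ) * Amat = Lam * (Amat * (n r)ᴴ * Amat) := by
      rw [← mul_assoc, Amat_mul_Lam]
      simp only [mul_assoc]
    have hd' : star d = -c := hd
    simp only [conjTranspose_add, conjTranspose_smul, conjTranspose_sub, conjTranspose_mul,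
      conjTranspose_Lam, hd', mul_add, add_mul, mul_sub, sub_mul, mul_smul_comm, smul_mul_assoc,
      h₁, h₂, h₃]
    module
  rw [hA]
  simp only [mul_add, sub_mul, mul_sub, mul_smul_comm, smul_mul_assoc, mul_assoc]
  module

theorem pdx_conj (f : ℝ × ℝ → ℂ) (p : ℝ × ℝ) :
    pdx (fun q => conj (f q)) p = conj (pdx f p) :=
  deriv.star

theorem V1mat_conjTranspose_mul_Amat (u v : ℝ × ℝ → ℂ) (lam : ℂ) (p : ℝ × ℝ) :
    (V1mat u v (conj lam) p)ᴴ * Amat = -(Amat * V1mat u v lam p) := by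
  ext i j
  fin_cases i <;> fin_cases j <;>
    simp [V1mat, U1mat, Amat, Matrix.mul_apply, Fin.sum_univ_three]

theorem V2mat_conjTranspose_mul_Amat (u v : ℝ × ℝ → ℂ) (lam : ℂ) (p : ℝ × ℝ) :
    (V2mat u v (conj lam) p)ᴴ * Amat = -(Amat * V2mat u v lam p) := by
  ext i j
  fin_cases i <;> fin_cases j <;>
    simp [V2mat, U1mat, U2mat, U3mat, rho, pdx_conj, Amat, Matrix.mul_apply,
      Fin.sum_univ_three, map_ofNat, -mul_eq_mul_left_iff] <;> ring

/-- **Remark 2.3.** If `μ(·,·,λ)` takes invertible values, is `C¹`, solves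
`μ_x + iλ²[Λ,μ] = V₁μ`, `μ_t − 2iλ⁴[Λ,μ] = V₂μ`, and at some base point `p₀` satisfies
`μ(p₀,λ)⁻¹ = A·conj(μ(p₀,conj λ))ᵀ·A` for every `λ`, then
`μ(x,t,λ)⁻¹ = A·conj(μ(x,t,conj λ))ᵀ·A` everywhere. -/
theorem mu_symmetry (u v : ℝ × ℝ → ℂ) (hu : ContDiff ℝ 1 u) (hv : ContDiff ℝ 1 v)
    (μ : ℂ → ℝ × ℝ → M3)
    (hμsmooth : ∀ (lam : ℂ) (i j : Fin 3), ContDiff ℝ 1 (fun p => μ lam p i j))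
    (hμinv : ∀ (lam : ℂ) (p : ℝ × ℝ), IsUnit (μ lam p))
    (hμx : ∀ (lam : ℂ) (p : ℝ × ℝ),
      pdxM (μ lam) p + (I * lam ^ 2) • (Lam * μ lam p - μ lam p * Lam)
        = V1mat u v lam p * μ lam p)
    (hμt : ∀ (lam : ℂ) (p : ℝ × ℝ),
      pdtM (μ lam) p - (2 * I * lam ^ 4) • (Lam * μ lam p - μ lam p * Lam)
        = V2mat u v lam p * μ lam p)
    (p₀ : ℝ × ℝ)
    (hbase : ∀ lam : ℂ,
      (μ lam p₀)⁻¹ = Amat * ((μ (conj lam) p₀).map (starRingEnd ℂ))ᵀ * Amat) :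
    ∀ (p : ℝ × ℝ) (lam : ℂ),
      (μ lam p)⁻¹ = Amat * ((μ (conj lam) p).map (starRingEnd ℂ))ᵀ * Amat := by
  have hdx : ∀ (lam : ℂ) (t s : ℝ) (i j : Fin 3),
      HasDerivAt (fun x => μ lam (x, t) i j) (((-(I * lam ^ 2)) • (Lam * μ lam (s, t)
        - μ lam (s, t) * Lam) + V1mat u v lam (s, t) * μ lam (s, t)) i j) s := by
    intro lam t s i j
    have hdiff : DifferentiableAt ℝ (fun x => μ lam (x, t) i j) s :=
      ((hμsmooth lam i j).differentiable one_ne_zero).comp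
        (differentiable_id.prodMk (differentiable_const t)) s
    refine hdiff.hasDerivAt.congr_deriv ?_
    rw [← hμx, neg_smul, neg_add_cancel_comm_assoc]
    rfl
  have hdt : ∀ (lam : ℂ) (x s : ℝ) (i j : Fin 3),
      HasDerivAt (fun t => μ lam (x, t) i j) (((2 * I * lam ^ 4) • (Lam * μ lam (x, s)
        - μ lam (x, s) * Lam) + V2mat u v lam (x, s) * μ lam (x, s)) i j) s := by
    intro lam x s i j
    have hdiff : DifferentiableAt ℝ (fun t => μ lam (x, t) i j) s :=
      ((hμsmooth lam i j).differentiable one_ne_zero).comp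
        ((differentiable_const x).prodMk differentiable_id) s
    refine hdiff.hasDerivAt.congr_deriv ?_
    rw [← hμt, add_sub_cancel]
    rfl
  intro p lam
  have hp₀ : Amat * (μ (conj lam) p₀)ᴴ * Amat * μ lam p₀ = 1 := by
    have hinv : (μ lam p₀)⁻¹ = Amat * (μ (conj lam) p₀)ᴴ * Amat := hbase lam
    rw [← hinv, nonsing_inv_mul _ ((isUnit_iff_isUnit_det _).mp (hμinv lam p₀))]
  have hx : Amat * (μ (conj lam) (p.1, p₀.2))ᴴ * Amat * μ lam (p.1, p₀.2) = 1 :=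
    Amat_conjTranspose_mul_eq_one (hdx lam p₀.2) (hdx (conj lam) p₀.2) (by simp)
      (fun s => V1mat_conjTranspose_mul_Amat u v lam (s, p₀.2)) (s₀ := p₀.1) hp₀ p.1
  exact inv_eq_left_inv
    (Amat_conjTranspose_mul_eq_one (hdt lam p.1) (hdt (conj lam) p.1) (by simp [map_ofNat])
      (fun s => V2mat_conjTranspose_mul_Amat u v lam (p.1, s)) (s₀ := p₀.2) hx p.2)
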